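/- (DPPI cushion integral equation) Under the DPPI assumptions, the cushion C_t := (1−α)V_0 exp(∫_0^t (m_s/S_s) dS_s − (1/2)∫_0^t (m_s²/S_s²) d[S]_s + ∫_0^t (1−m_s) r_s ds) satisfies the pathwise integral equation C_t − C_0 = ∫_0^t (m_s C_s / S_s) dS_s + ∫_0^t (1 − m_s) C_s r_s ds for all t ≥ 0, where the first integral is the pathwise Itô integral along (T_N) and m_s C_s / S_s is an admissible integrand for S. -/

import Mathlib

open Filter Topology Set MeasureTheory

/-- A refining sequence of time grids: each grid is a strictly increasing
sequence starting at 0 and tending to infinity; grids are nested and the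
mesh tends to zero. -/
structure GridSeq where
  T : ℕ → ℕ → ℝ
  zero : ∀ N, T N 0 = 0
  mono : ∀ N, StrictMono (T N)
  unbounded : ∀ N, Filter.Tendsto (T N) Filter.atTop Filter.atTop
  nested : ∀ N, Set.range (T N) ⊆ Set.range (T (N + 1))
  mesh : ∀ ε > 0, ∃ N₀, ∀ N ≥ N₀, ∀ i, T N (i + 1) - T N i ≤ ε

/-- The grid sum `∑_{t_i, t_{i+1} ∈ τ, t_{i+1} ≤ t} f(t_i, t_{i+1})`. -/
noncomputable def gridSum (τ : ℕ → ℝ) (f : ℝ → ℝ → ℝ) (t : ℝ) : ℝ :=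
  ∑' i : ℕ, if τ (i + 1) ≤ t then f (τ i) (τ (i + 1)) else 0

/-- The grid sums of `f` along the grid sequence `G` converge to `L` at time `t`. -/
def ConvTo (G : GridSeq) (f : ℝ → ℝ → ℝ) (t L : ℝ) : Prop :=
  Filter.Tendsto (fun N => gridSum (G.T N) f t) Filter.atTop (nhds L)

/-- `X` has continuous quadratic variation `Q` along the grid sequence `G`. -/
def HasQV (G : GridSeq) (X Q : ℝ → ℝ) : Prop :=
  ContinuousOn Q (Set.Ici 0) ∧ Q 0 = 0 ∧
    ∀ t, ConvTo G (fun u v => (X v - X u) ^ 2) t (Q t)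

/-- `A` is locally of finite variation on `[0,∞)`. -/
def LocBV (A : ℝ → ℝ) : Prop := ∀ T > 0, BoundedVariationOn A (Set.Icc 0 T)

/-- `ξ` is an admissible integrand for `X`: locally `ξ_t = g(A_t, X_t)` with
`g ∈ C¹` and `A` continuous of finite variation. -/
def Admissible (X ξ : ℝ → ℝ) : Prop :=
  ∀ T > 0, ∃ (n : ℕ) (g : (Fin n → ℝ) → ℝ → ℝ) (A : ℝ → Fin n → ℝ),
    ContDiff ℝ 1 (Function.uncurry g) ∧
    (∀ k, ContinuousOn (fun t => A t k) (Set.Icc 0 T) ∧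
      BoundedVariationOn (fun t => A t k) (Set.Icc 0 T)) ∧
    ∀ t ∈ Set.Icc (0 : ℝ) T, ξ t = g (A t) (X t)

/-- The number of cells `[t_i, t_{i+1}]` of the `N`-th grid with `t_{i+1} ≤ t`. -/
noncomputable def GridSeq.idx (G : GridSeq) (N : ℕ) (t : ℝ) : ℕ :=
  sInf {k | t < G.T N (k + 1)}

namespace GridSeq

variable (G : GridSeq) {N : ℕ} {s t : ℝ}

lemma lt_T_idx_succ (N : ℕ) (t : ℝ) : t < G.T N (G.idx N t + 1) := by
  have h : {k | t < G.T N (k + 1)}.Nonempty := by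
    have := ((G.unbounded N).comp (tendsto_add_atTop_nat 1)).eventually_gt_atTop t
    exact this.exists
  exact Nat.sInf_mem h

lemma lt_idx_iff {i : ℕ} : i < G.idx N t ↔ G.T N (i + 1) ≤ t := by
  constructor
  · intro h
    by_contra! h'
    exact absurd (Nat.sInf_le (s := {k | t < G.T N (k + 1)}) h') (not_le.2 h)
  · intro h
    have := (G.mono N).lt_iff_lt.1 (h.trans_lt (G.lt_T_idx_succ N t))
    omega

lemma T_nonneg (N i : ℕ) : 0 ≤ G.T N i := by
  rw [← G.zero N]; exact (G.mono N).monotone (Nat.zero_le i)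

lemma T_idx_le (ht : 0 ≤ t) : G.T N (G.idx N t) ≤ t := by
  rcases h : G.idx N t with _ | k
  · rwa [G.zero]
  · exact G.lt_idx_iff.1 (by omega)

lemma idx_mono (hst : s ≤ t) : G.idx N s ≤ G.idx N t := by
  by_contra! h
  exact absurd ((G.lt_idx_iff.1 h).trans hst) (not_le.2 (G.lt_T_idx_succ N t))

lemma gridSum_eq (N : ℕ) (f : ℝ → ℝ → ℝ) (t : ℝ) :
    gridSum (G.T N) f t = ∑ i ∈ Finset.range (G.idx N t), f (G.T N i) (G.T N (i + 1)) := by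
  rw [gridSum, tsum_eq_sum (s := Finset.range (G.idx N t))]
  · refine Finset.sum_congr rfl fun i hi => if_pos ?_
    exact G.lt_idx_iff.1 (Finset.mem_range.1 hi)
  · intro i hi
    refine if_neg fun h => hi ?_
    exact Finset.mem_range.2 (G.lt_idx_iff.2 h)

lemma tendsto_T_idx (ht : 0 ≤ t) : Tendsto (fun N => G.T N (G.idx N t)) atTop (𝓝 t) := by
  rw [Metric.tendsto_atTop]
  intro ε hε
  obtain ⟨N₀, hN₀⟩ := G.mesh (ε / 2) (by positivity)
  refine ⟨N₀, fun N hN => ?_⟩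
  have h1 := G.T_idx_le (N := N) ht
  have h2 := G.lt_T_idx_succ N t
  have h3 := hN₀ N hN (G.idx N t)
  rw [Real.dist_eq, abs_lt]
  constructor <;> linarith

end GridSeq

namespace ConvTo

variable {G : GridSeq} {f g p : ℝ → ℝ → ℝ} {s t a b : ℝ}

lemma add (hf : ConvTo G f t a) (hg : ConvTo G g t b) :
    ConvTo G (fun u v => f u v + g u v) t (a + b) := by
  refine (Tendsto.add hf hg).congr fun N => ?_
  simp only [G.gridSum_eq, Finset.sum_add_distrib]

lemma const_mul (c : ℝ) (hf : ConvTo G f t a) : ConvTo G (fun u v => c * f u v) t (c * a) := by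
  refine (Tendsto.const_mul c hf).congr fun N => ?_
  simp only [G.gridSum_eq, Finset.mul_sum]

lemma sub (hf : ConvTo G f t a) (hg : ConvTo G g t b) :
    ConvTo G (fun u v => f u v - g u v) t (a - b) := by
  refine (Tendsto.sub hf hg).congr fun N => ?_
  simp only [G.gridSum_eq, Finset.sum_sub_distrib]

lemma zero : ConvTo G (fun _ _ => 0) t 0 := by
  refine tendsto_const_nhds.congr fun N => ?_
  simp [G.gridSum_eq]

lemma finset_sum {ι : Type*} {f : ι → ℝ → ℝ → ℝ} {a : ι → ℝ} (I : Finset ι)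
    (h : ∀ i ∈ I, ConvTo G (f i) t (a i)) :
    ConvTo G (fun u v => ∑ i ∈ I, f i u v) t (∑ i ∈ I, a i) := by
  refine (tendsto_finsetSum I h).congr fun N => ?_
  simp only [G.gridSum_eq]
  exact Finset.sum_comm

/-- Convergence at `t` only depends on the values at pairs `0 ≤ u < v ≤ t`. -/
lemma congr (hf : ConvTo G f t a) (h : ∀ u v, 0 ≤ u → u < v → v ≤ t → f u v = g u v) :
    ConvTo G g t a := by
  refine Tendsto.congr (fun N => ?_) hf
  simp only [G.gridSum_eq]
  refine Finset.sum_congr rfl fun i hi => h _ _ (G.T_nonneg N i) (G.mono N (Nat.lt_succ_self i)) ?_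
  exact G.lt_idx_iff.1 (Finset.mem_range.1 hi)

/-- Sums up to `s` are sums up to `t ≥ s` of the truncated summand. -/
lemma truncate (hf : ConvTo G f s a) (hst : s ≤ t) :
    ConvTo G (fun u v => if v ≤ s then f u v else 0) t a := by
  refine Tendsto.congr (fun N => ?_) hf
  refine tsum_congr fun i => ?_
  split_ifs with h1 h2 h2
  · simp [h1]
  · exact absurd (h1.trans hst) h2
  · simp [h1]
  · rfl

lemma unique (hf : ConvTo G f t a) (hg : ConvTo G f t b) : a = b := tendsto_nhds_unique hf hg

/-- Increments of a continuous function telescope. -/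
lemma increments {Y : ℝ → ℝ} (ht : 0 ≤ t) (hY : ContinuousOn Y (Icc 0 t)) :
    ConvTo G (fun u v => Y v - Y u) t (Y t - Y 0) := by
  have h1 : Tendsto (fun N => G.T N (G.idx N t)) atTop (𝓝[Icc 0 t] t) :=
    tendsto_nhdsWithin_iff.2 ⟨G.tendsto_T_idx ht,
      Eventually.of_forall fun N => ⟨G.T_nonneg _ _, G.T_idx_le ht⟩⟩
  have h2 := ((hY t ⟨ht, le_rfl⟩).tendsto.comp h1).sub_const (Y 0)
  refine h2.congr fun N => ?_
  rw [G.gridSum_eq, Finset.sum_range_sub (fun i => Y (G.T N i)), G.zero]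
  rfl

/-- A summand dominated by the increments of the limit of `p` has limit dominated likewise. -/
lemma abs_sub_le {A A' P P' : ℝ} (hfs : ConvTo G f s A) (hft : ConvTo G f t A')
    (hps : ConvTo G p s P) (hpt : ConvTo G p t P') (hst : s ≤ t)
    (h : ∀ u v, 0 ≤ u → u < v → v ≤ t → |f u v| ≤ p u v) : |A' - A| ≤ P' - P := by
  refine le_of_tendsto_of_tendsto' ((Tendsto.sub hft hfs).abs) (Tendsto.sub hpt hps) fun N => ?_
  simp only [G.gridSum_eq]
  rw [← Finset.sum_Ico_eq_sub _ (G.idx_mono hst), ← Finset.sum_Ico_eq_sub _ (G.idx_mono hst)]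
  refine (Finset.abs_sum_le_sum_abs _ _).trans (Finset.sum_le_sum fun i hi => ?_)
  exact h _ _ (G.T_nonneg N i) (G.mono N (Nat.lt_succ_self i))
    (G.lt_idx_iff.1 (Finset.mem_Ico.1 hi).2)

/-- A summand that is approximated, relatively to `p`, by null summands on fine grids is null. -/
lemma zero_of_approx {P : ℝ} (hp : ConvTo G p t P)
    (h : ∀ ε > 0, ∃ f', ConvTo G f' t 0 ∧ ∃ δ > 0, ∀ u v, 0 ≤ u → u < v → v ≤ t → v - u ≤ δ →
      |f u v - f' u v| ≤ ε * p u v) : ConvTo G f t 0 := by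
  refine Metric.tendsto_atTop.2 fun ε hε => ?_
  obtain ⟨f', hf', δ, hδ, hd⟩ := h (ε / (2 * (|P| + 1))) (by positivity)
  obtain ⟨N₀, hN₀⟩ := G.mesh δ hδ
  have e1 : ∀ᶠ N in atTop, gridSum (G.T N) p t < |P| + 1 :=
    Tendsto.eventually_lt_const (by linarith [le_abs_self P]) hp
  have e2 : ∀ᶠ N in atTop, |gridSum (G.T N) f' t| < ε / 2 := by
    have := Tendsto.abs hf'
    rw [abs_zero] at this
    exact this.eventually_lt_const (by positivity)
  obtain ⟨N₁, hN₁⟩ := eventually_atTop.1 (e1.and e2)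
  refine ⟨max N₀ N₁, fun N hN => ?_⟩
  obtain ⟨h1, h2⟩ := hN₁ N ((le_max_right _ _).trans hN)
  have h3 : |gridSum (G.T N) f t - gridSum (G.T N) f' t|
      ≤ ε / (2 * (|P| + 1)) * gridSum (G.T N) p t := by
    simp only [G.gridSum_eq]
    rw [← Finset.sum_sub_distrib, Finset.mul_sum]
    refine (Finset.abs_sum_le_sum_abs _ _).trans (Finset.sum_le_sum fun i hi => ?_)
    exact hd _ _ (G.T_nonneg N i) (G.mono N (Nat.lt_succ_self i))
      (G.lt_idx_iff.1 (Finset.mem_range.1 hi)) (hN₀ N ((le_max_left _ _).trans hN) i)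
  have h4 : ε / (2 * (|P| + 1)) * gridSum (G.T N) p t ≤ ε / 2 := by
    have : ε / (2 * (|P| + 1)) * (|P| + 1) = ε / 2 := by field_simp
    rw [← this]
    gcongr
  rw [Real.dist_eq, sub_zero]
  have := abs_sub_abs_le_abs_sub (gridSum (G.T N) f t) (gridSum (G.T N) f' t)
  linarith

lemma zero_of_small {P : ℝ} (hp : ConvTo G p t P)
    (h : ∀ ε > 0, ∃ δ > 0, ∀ u v, 0 ≤ u → u < v → v ≤ t → v - u ≤ δ → |f u v| ≤ ε * p u v) :
    ConvTo G f t 0 := by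
  refine zero_of_approx hp fun ε hε => ⟨_, zero, ?_⟩
  simpa only [sub_zero] using h ε hε

/-- If the grid sums of `e` vanish in the limit at all times up to `t` and `e` is dominated by
a summand with convergent sums, the same holds for `c · e` with `c` continuous. -/
lemma continuousOn_mul {c : ℝ → ℝ} {e : ℝ → ℝ → ℝ} {P : ℝ} (hc : ContinuousOn c (Icc 0 t))
    (hp : ConvTo G p t P) (he : ∀ s ∈ Icc 0 t, ConvTo G e s 0)
    (hep : ∀ u v, 0 ≤ u → u < v → v ≤ t → |e u v| ≤ p u v) :
    ConvTo G (fun u v => c u * e u v) t 0 := by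
  rcases lt_or_ge 0 t with ht | ht
  swap
  · exact zero.congr fun u v hu huv hv => by linarith
  refine zero_of_approx hp fun ε hε => ?_
  have huc := isCompact_Icc.uniformContinuousOn_of_continuous hc
  rw [Metric.uniformContinuousOn_iff_le] at huc
  obtain ⟨δ, hδ, hcδ⟩ := huc ε hε
  obtain ⟨n, hn⟩ := exists_nat_gt (2 * t / δ)
  have hn0 : (0 : ℝ) < n := lt_of_le_of_lt (by positivity) hn
  set d : ℝ := t / n with hd
  have hd0 : 0 < d := by positivity
  have hnd : n * d = t := by rw [hd]; field_simp
  have hdδ : d ≤ δ / 2 := by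
    rw [div_lt_iff₀ hδ] at hn
    rw [hd, div_le_iff₀ hn0]; linarith
  have hle : ∀ j : ℕ, j ≤ n → (j : ℝ) * d ≤ t := fun j hj => by
    rw [← hnd]; gcongr
  refine ⟨fun u v => ∑ j ∈ Finset.range n, c (j * d) *
    ((if v ≤ ((j + 1 : ℕ) : ℝ) * d then e u v else 0) - (if v ≤ (j : ℝ) * d then e u v else 0)),
    ?_, δ / 2, by positivity, ?_⟩
  · have : ConvTo G (fun u v => ∑ j ∈ Finset.range n, c (j * d) *
      ((if v ≤ ((j + 1 : ℕ) : ℝ) * d then e u v else 0) -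
        (if v ≤ (j : ℝ) * d then e u v else 0))) t
        (∑ j ∈ Finset.range n, c (j * d) * (0 - 0)) := by
      refine finset_sum _ fun j hj => const_mul _ (sub ?_ ?_)
      · have := hle (j + 1) (Finset.mem_range.1 hj)
        exact (he _ ⟨by positivity, this⟩).truncate this
      · have := hle j (Finset.mem_range.1 hj).le
        exact (he _ ⟨by positivity, this⟩).truncate this
    simpa using this
  · intro u v hu huv hv huvδ
    obtain ⟨k, hk⟩ : ∃ k, ⌈v / d⌉₊ = k + 1 :=
      Nat.exists_eq_succ_of_ne_zero (Nat.ceil_pos.2 (div_pos (by linarith) hd0)).ne'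
    have hk1 : (k : ℝ) * d < v := by
      rw [← lt_div_iff₀ hd0]; exact Nat.lt_ceil.1 (by omega)
    have hk2 : v ≤ ((k + 1 : ℕ) : ℝ) * d := by
      rw [← div_le_iff₀ hd0, ← hk]; exact Nat.le_ceil _
    have hkn : k < n := by
      have : (k : ℝ) * d < n * d := by rw [hnd]; linarith
      exact_mod_cast lt_of_mul_lt_mul_right this hd0.le
    beta_reduce
    rw [Finset.sum_eq_single_of_mem k (Finset.mem_range.2 hkn)]
    · rw [if_pos hk2, if_neg (not_le.2 hk1), sub_zero, ← sub_mul, abs_mul]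
      refine mul_le_mul ?_ (hep u v hu huv hv) (abs_nonneg _) hε.le
      refine hcδ u ⟨hu, by linarith⟩ _ ⟨by positivity, by linarith⟩ ?_
      push_cast at hk2
      rw [Real.dist_eq, abs_le]
      constructor <;> linarith
    · intro j _ hjk
      rcases lt_or_gt_of_ne hjk with hlt | hgt
      · have h1 : ((j + 1 : ℕ) : ℝ) * d ≤ k * d := by gcongr; exact hlt
        have h2 : (j : ℝ) * d ≤ k * d := by gcongr
        rw [if_neg (by linarith), if_neg (by linarith), sub_zero, mul_zero]
      · have h1 : ((k + 1 : ℕ) : ℝ) * d ≤ j * d := by gcongr; exact hgt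
        have h2 : (j : ℝ) * d ≤ ((j + 1 : ℕ) : ℝ) * d := by gcongr; omega
        rw [if_pos (by linarith), if_pos (by linarith), sub_self, mul_zero]

end ConvTo


/-- A function whose increments are dominated by those of a continuous one is continuous. -/
lemma continuousOn_of_abs_sub_le {f W : ℝ → ℝ} {T : ℝ} (hW : ContinuousOn W (Icc 0 T))
    (h : ∀ u v, 0 ≤ u → u < v → v ≤ T → |f v - f u| ≤ W v - W u) : ContinuousOn f (Icc 0 T) := by
  have key : ∀ x ∈ Icc 0 T, ∀ y ∈ Icc 0 T, |f y - f x| ≤ |W y - W x| := by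
    intro x hx y hy
    rcases lt_trichotomy x y with hxy | rfl | hxy
    · exact (h x y hx.1 hxy hy.2).trans (le_abs_self _)
    · simp
    · rw [abs_sub_comm, abs_sub_comm (W y)]
      exact (h y x hy.1 hxy hx.2).trans (le_abs_self _)
  intro x hx
  have h1 : Tendsto (fun y => |W y - W x|) (𝓝[Icc 0 T] x) (𝓝 0) := by
    simpa using ((hW x hx).tendsto.sub_const (W x)).abs
  rw [ContinuousWithinAt, tendsto_iff_dist_tendsto_zero]
  refine squeeze_zero' (Eventually.of_forall fun _ => dist_nonneg) ?_ h1
  filter_upwards [self_mem_nhdsWithin] with y hy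
  exact key x hx y hy

/-- Second order expansion of `exp (x + y)` when `y` is of the order of `x ^ 2`. -/
lemma abs_exp_add_sub_le {x y η : ℝ} (hη : η ≤ 1 / 2) (hx : |x| ≤ η) (hy : |y| ≤ η) :
    |Real.exp (x + y) - 1 - (x + y) - x ^ 2 / 2| ≤ 3 * η * (x ^ 2 + |y|) := by
  have hη0 : 0 ≤ η := (abs_nonneg x).trans hx
  have hz : |x + y| ≤ 2 * η := (abs_add_le x y).trans (by linarith)
  have h1 := Real.exp_bound (x := x + y) (by linarith) (n := 3) (by norm_num)
  simp only [Finset.sum_range_succ, Finset.sum_range_zero, Nat.factorial] at h1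
  norm_num at h1
  have h2 : |x + y| ^ 3 ≤ 2 * η * (2 * (x ^ 2 + η * |y|)) := by
    have h3 : |x + y| ^ 2 ≤ 2 * (x ^ 2 + η * |y|) := by
      rw [sq_abs]
      nlinarith [sq_nonneg (x - y), mul_le_mul_of_nonneg_right hy (abs_nonneg y), sq_abs y]
    calc |x + y| ^ 3 = |x + y| * |x + y| ^ 2 := by ring
      _ ≤ _ := by gcongr
  have h4 : |(x + y) ^ 2 / 2 - x ^ 2 / 2| ≤ 3 / 2 * η * |y| := by
    have : (x + y) ^ 2 / 2 - x ^ 2 / 2 = (x + y / 2) * y := by ring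
    rw [this, abs_mul]
    gcongr
    calc |x + y / 2| ≤ |x| + |y / 2| := abs_add_le _ _
      _ ≤ 3 / 2 * η := by rw [abs_div, abs_two]; linarith
  have h5 : |Real.exp (x + y) - 1 - (x + y) - x ^ 2 / 2| ≤
      |x + y| ^ 3 * (2 / 9) + 3 / 2 * η * |y| := by
    refine le_trans ?_ (add_le_add h1 h4)
    refine le_trans (le_of_eq ?_) (abs_add_le _ _)
    congr 1; ring
  have h6 : η * (η * |y|) ≤ 1 / 2 * (η * |y|) :=
    mul_le_mul_of_nonneg_right hη (by positivity)
  have h7 : 0 ≤ η * |y| := by positivity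
  have h8 : 0 ≤ η * x ^ 2 := by positivity
  nlinarith

lemma exists_pos_abs_le {f : ℝ → ℝ} {T : ℝ} (hf : ContinuousOn f (Icc 0 T)) :
    ∃ M > 0, ∀ t ∈ Icc 0 T, |f t| ≤ M := by
  obtain ⟨M, hM⟩ := isCompact_Icc.exists_bound_of_continuousOn hf
  exact ⟨max M 1, by positivity, fun t ht => (hM t ht).trans (le_max_left _ _)⟩

lemma exists_pos_abs_sub_le {f : ℝ → ℝ} {T : ℝ} (hf : ContinuousOn f (Icc 0 T)) {ε : ℝ}
    (hε : 0 < ε) : ∃ δ > 0, ∀ u v, 0 ≤ u → u < v → v ≤ T → v - u ≤ δ → |f v - f u| ≤ ε := by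
  have h := isCompact_Icc.uniformContinuousOn_of_continuous hf
  rw [Metric.uniformContinuousOn_iff_le] at h
  obtain ⟨δ, hδ, h⟩ := h ε hε
  refine ⟨δ, hδ, fun u v hu huv hv hd => h v ⟨by linarith, hv⟩ u ⟨hu, by linarith⟩ ?_⟩
  rw [Real.dist_eq, abs_of_pos (by linarith)]
  exact hd

lemma integral_sub_of_lt {f : ℝ → ℝ} {T u v : ℝ} (hf : IntervalIntegrable f volume 0 T)
    (hu : 0 ≤ u) (huv : u < v) (hv : v ≤ T) :
    (∫ s in (0 : ℝ)..v, f s) - ∫ s in (0 : ℝ)..u, f s = ∫ s in u..v, f s := by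
  refine intervalIntegral.integral_interval_sub_left (hf.mono_set ?_) (hf.mono_set ?_) <;>
  · rw [uIcc_of_le (by linarith), uIcc_of_le (by linarith)]
    exact Icc_subset_Icc_right (by linarith)

lemma continuousOn_integral {f : ℝ → ℝ} {T : ℝ} (hT : 0 ≤ T)
    (hf : IntervalIntegrable f volume 0 T) :
    ContinuousOn (fun t => ∫ s in (0 : ℝ)..t, f s) (Icc 0 T) := by
  have := intervalIntegral.continuousOn_primitive_interval' hf left_mem_uIcc
  rwa [uIcc_of_le hT] at this

lemma abs_integral_sub_le {f : ℝ → ℝ} {T u v : ℝ} (hf : IntervalIntegrable f volume 0 T)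
    (hu : 0 ≤ u) (huv : u < v) (hv : v ≤ T) :
    |(∫ s in (0 : ℝ)..v, f s) - ∫ s in (0 : ℝ)..u, f s| ≤
      (∫ s in (0 : ℝ)..v, |f s|) - ∫ s in (0 : ℝ)..u, |f s| := by
  rw [integral_sub_of_lt hf hu huv hv, integral_sub_of_lt hf.abs hu huv hv]
  exact intervalIntegral.abs_integral_le_integral_abs huv.le

/-- Quadratic variation along grids is monotone. -/
lemma qv_mono {G : GridSeq} {S Q : ℝ → ℝ} {T : ℝ}
    (hQS : ∀ t ∈ Icc 0 T, ConvTo G (fun u v => (S v - S u) ^ 2) t (Q t)) :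
    ∀ u v, 0 ≤ u → u < v → v ≤ T → 0 ≤ Q v - Q u := by
  intro u v hu huv hv
  have := ConvTo.abs_sub_le (f := fun _ _ => 0) ConvTo.zero ConvTo.zero
    (hQS u ⟨hu, by linarith⟩) (hQS v ⟨by linarith, hv⟩) huv.le (fun _ _ _ _ _ => by simp; positivity)
  simpa using this

/-- Increments of `∫ θ² d[S]` are dominated by those of `[S]`. -/
lemma qv_integral_abs_sub_le {G : GridSeq} {S Q θ I : ℝ → ℝ} {T M : ℝ}
    (hQc : ContinuousOn Q (Icc 0 T))
    (hQS : ∀ t ∈ Icc 0 T, ConvTo G (fun u v => (S v - S u) ^ 2) t (Q t))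
    (hI : ∀ t ∈ Icc 0 T, ConvTo G (fun u v => θ u ^ 2 * (Q v - Q u)) t (I t))
    (hM : ∀ t ∈ Icc 0 T, |θ t| ≤ M) :
    ∀ u v, 0 ≤ u → u < v → v ≤ T → |I v - I u| ≤ M ^ 2 * (Q v - Q u) := by
  intro u v hu huv hv
  have hinc : ∀ s ∈ Icc 0 T, ConvTo G (fun u v => M ^ 2 * (Q v - Q u)) s (M ^ 2 * (Q s - Q 0)) :=
    fun s hs => (ConvTo.increments hs.1 (hQc.mono (Icc_subset_Icc_right hs.2))).const_mul _
  have := ConvTo.abs_sub_le (hI u ⟨hu, by linarith⟩) (hI v ⟨by linarith, hv⟩)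
    (hinc u ⟨hu, by linarith⟩) (hinc v ⟨by linarith, hv⟩) huv.le (fun a b ha hab hb => by
      have h0 := qv_mono hQS a b ha hab (hb.trans hv)
      rw [abs_mul, abs_of_nonneg h0, abs_pow]
      gcongr
      exact hM a ⟨ha, by linarith⟩)
  linarith

/-- The exponential of `∫ θ dS - ½ ∫ θ² d[S] + ∫ ρ ds` solves the linear integral equation,
provided the pathwise integral `∫ θ dS` is regular in the sense of `hbound`. -/
lemma ConvTo.exponential {G : GridSeq} {S Q θ I₁ I₂ ρ W C : ℝ → ℝ} {T K c : ℝ} (hT : 0 ≤ T)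
    (hS : ContinuousOn S (Icc 0 T)) (hQc : ContinuousOn Q (Icc 0 T))
    (hQS : ∀ t ∈ Icc 0 T, ConvTo G (fun u v => (S v - S u) ^ 2) t (Q t))
    (hθ : ContinuousOn θ (Icc 0 T))
    (hI₁c : ContinuousOn I₁ (Icc 0 T))
    (hI₁ : ∀ t ∈ Icc 0 T, ConvTo G (fun u v => θ u * (S v - S u)) t (I₁ t))
    (hI₂ : ∀ t ∈ Icc 0 T, ConvTo G (fun u v => θ u ^ 2 * (Q v - Q u)) t (I₂ t))
    (hW : ContinuousOn W (Icc 0 T)) (hWm : MonotoneOn W (Icc 0 T)) (hK : 0 ≤ K)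
    (hbound : ∀ u v, 0 ≤ u → u < v → v ≤ T →
      |I₁ v - I₁ u - θ u * (S v - S u)| ≤ W v - W u + K * (S v - S u) ^ 2)
    (hρ : IntervalIntegrable ρ volume 0 T)
    (hC : ∀ t, C t = c * Real.exp (I₁ t - I₂ t / 2 + ∫ s in (0 : ℝ)..t, ρ s)) :
    ∀ t ∈ Icc 0 T, ConvTo G (fun u v => θ u * C u * (S v - S u)) t
      (C t - C 0 - ∫ s in (0 : ℝ)..t, C s * ρ s) := by
  have hinc : ∀ {Y : ℝ → ℝ}, ContinuousOn Y (Icc 0 T) → ∀ t ∈ Icc 0 T,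
      ConvTo G (fun u v => Y v - Y u) t (Y t - Y 0) :=
    fun hY t ht => ConvTo.increments ht.1 (hY.mono (Icc_subset_Icc_right ht.2))
  have hat0 : ∀ {f : ℝ → ℝ → ℝ} {a : ℝ}, ConvTo G f 0 a → a = 0 := fun h =>
    h.unique (ConvTo.zero.congr fun u v hu huv hv => by linarith)
  have h0T : (0 : ℝ) ∈ Icc 0 T := ⟨le_rfl, hT⟩
  have hQ0 : Q 0 = 0 := hat0 (hQS 0 h0T)
  have hI₁0 : I₁ 0 = 0 := hat0 (hI₁ 0 h0T)
  have hI₂0 : I₂ 0 = 0 := hat0 (hI₂ 0 h0T)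
  obtain ⟨M, hM0, hM⟩ := exists_pos_abs_le hθ
  have hQm := qv_mono hQS
  have hI₂le := qv_integral_abs_sub_le hQc hQS hI₂ hM
  have hI₂c : ContinuousOn I₂ (Icc 0 T) :=
    continuousOn_of_abs_sub_le (W := fun t => M ^ 2 * Q t) (continuousOn_const.mul hQc)
      fun u v hu huv hv => (hI₂le u v hu huv hv).trans_eq (by ring)
  set R : ℝ → ℝ := fun t => ∫ s in (0 : ℝ)..t, ρ s with hR
  set R' : ℝ → ℝ := fun t => ∫ s in (0 : ℝ)..t, |ρ s| with hR'
  have hRc : ContinuousOn R (Icc 0 T) := continuousOn_integral hT hρ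
  have hR'c : ContinuousOn R' (Icc 0 T) := continuousOn_integral hT hρ.abs
  have hRle : ∀ u v, 0 ≤ u → u < v → v ≤ T → |R v - R u| ≤ R' v - R' u :=
    fun u v => abs_integral_sub_le hρ
  set X : ℝ → ℝ := fun t => I₁ t - I₂ t / 2 + R t with hX
  have hXc : ContinuousOn X (Icc 0 T) := (hI₁c.sub (hI₂c.div_const 2)).add hRc
  have hCX : ∀ t, C t = c * Real.exp (X t) := hC
  have hCc : ContinuousOn C (Icc 0 T) :=
    (continuousOn_const.mul hXc.rexp).congr fun t _ => hCX t
  have hCρ : IntervalIntegrable (fun s => C s * ρ s) volume 0 T :=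
    hρ.continuousOn_mul (by rwa [uIcc_of_le hT])
  set P : ℝ → ℝ := fun t => ∫ s in (0 : ℝ)..t, C s * ρ s with hP
  have hPc : ContinuousOn P (Icc 0 T) := continuousOn_integral hT hCρ
  obtain ⟨M', hM'0, hM'⟩ := exists_pos_abs_le hCc
  set V : ℝ → ℝ := fun t => W t + Q t + R' t with hV
  have hVc : ContinuousOn V (Icc 0 T) := (hW.add hQc).add hR'c
  set p : ℝ → ℝ → ℝ := fun u v => (S v - S u) ^ 2 + (V v - V u) with hp
  have hpconv : ∀ t ∈ Icc 0 T, ConvTo G p t (Q t + (V t - V 0)) :=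
    fun t ht => (hQS t ht).add (hinc hVc t ht)
  have hparts : ∀ u v, 0 ≤ u → u < v → v ≤ T → 0 ≤ W v - W u ∧ 0 ≤ Q v - Q u ∧ 0 ≤ R' v - R' u :=
    fun u v hu huv hv => ⟨sub_nonneg.2 (hWm ⟨hu, by linarith⟩ ⟨by linarith, hv⟩ huv.le),
      hQm u v hu huv hv, (abs_nonneg _).trans (hRle u v hu huv hv)⟩
  have hle : ∀ {a b u v x : ℝ}, 0 ≤ a → 0 ≤ b → 0 ≤ u → u < v → v ≤ T →
      x ≤ a * (S v - S u) ^ 2 + b * (V v - V u) → x ≤ (a + b) * p u v := by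
    intro a b u v x ha hb hu huv hv hx
    obtain ⟨h1, h2, h3⟩ := hparts u v hu huv hv
    have hV0 : 0 ≤ V v - V u := by simp only [hV]; linarith
    have := mul_nonneg ha hV0
    have := mul_nonneg hb (sq_nonneg (S v - S u))
    simp only [hp]; linarith
  have hp0 : ∀ u v, 0 ≤ u → u < v → v ≤ T → 0 ≤ p u v := fun u v hu huv hv => by
    simpa using hle (x := 0) (a := 1) (b := 0) zero_le_one le_rfl hu huv hv
      (by simpa using sq_nonneg _)
  -- the first order remainder of `I₁`
  have he : ∀ t ∈ Icc 0 T, ConvTo G (fun u v => (I₁ v - I₁ u) - θ u * (S v - S u)) t 0 := by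
    intro t ht
    have := (hinc hI₁c t ht).sub (hI₁ t ht)
    rwa [hI₁0, sub_zero, sub_self] at this
  have hele : ∀ u v, 0 ≤ u → u < v → v ≤ T →
      |(I₁ v - I₁ u) - θ u * (S v - S u)| ≤ (K + 1) * p u v := by
    intro u v hu huv hv
    obtain ⟨h1, h2, h3⟩ := hparts u v hu huv hv
    refine hle hK zero_le_one hu huv hv ((hbound u v hu huv hv).trans ?_)
    simp only [hV]; linarith
  -- replacing squared increments by `I₂`
  have hsq : ∀ t ∈ Icc 0 T,
      ConvTo G (fun u v => θ u ^ 2 * (S v - S u) ^ 2 - (I₂ v - I₂ u)) t 0 := by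
    intro t ht
    have h1 : ConvTo G (fun u v => θ u ^ 2 * ((S v - S u) ^ 2 - (Q v - Q u))) t 0 := by
      refine ConvTo.continuousOn_mul (c := fun u => θ u ^ 2) (P := 1 * (Q t + (V t - V 0)))
        ((hθ.pow 2).mono (Icc_subset_Icc_right ht.2)) ((hpconv t ht).const_mul 1) ?_ ?_
      · intro s hs
        have hs' : s ∈ Icc 0 T := ⟨hs.1, hs.2.trans ht.2⟩
        have := (hQS s hs').sub (hinc hQc s hs')
        rwa [hQ0, sub_zero, sub_self] at this
      · intro u v hu huv hv
        obtain ⟨h1, h2, h3⟩ := hparts u v hu huv (hv.trans ht.2)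
        have := sq_nonneg (S v - S u)
        simp only [hp, hV]
        rw [abs_le]; constructor <;> linarith
    have h2 := (h1.add (hI₂ t ht)).sub (hinc hI₂c t ht)
    rw [hI₂0, zero_add, sub_zero, sub_self] at h2
    exact h2.congr fun u v _ _ _ => by ring
  have hsqle : ∀ u v, 0 ≤ u → u < v → v ≤ T →
      |θ u ^ 2 * (S v - S u) ^ 2 - (I₂ v - I₂ u)| ≤ (M ^ 2 + M ^ 2) * p u v := by
    intro u v hu huv hv
    obtain ⟨h1, h2, h3⟩ := hparts u v hu huv hv
    refine hle (sq_nonneg M) (sq_nonneg M) hu huv hv ((abs_sub _ _).trans (add_le_add ?_ ?_))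
    · rw [abs_mul, abs_pow, abs_pow, sq_abs (S v - S u)]
      gcongr
      exact hM u ⟨hu, by linarith⟩
    · refine (hI₂le u v hu huv hv).trans (mul_le_mul_of_nonneg_left ?_ (sq_nonneg M))
      simp only [hV]; linarith
  intro t ht
  have hsub : Icc 0 t ⊆ Icc 0 T := Icc_subset_Icc_right ht.2
  have hmem : ∀ s ∈ Icc 0 t, s ∈ Icc 0 T := fun s hs => hsub hs
  have c1 : ConvTo G (fun u v => C u * ((I₁ v - I₁ u) - θ u * (S v - S u))) t 0 :=
    ConvTo.continuousOn_mul (hCc.mono hsub) ((hpconv t ht).const_mul _) (fun s hs => he s (hmem s hs))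
      fun u v hu huv hv => hele u v hu huv (hv.trans ht.2)
  have c2 : ConvTo G (fun u v => C u * (θ u ^ 2 * (S v - S u) ^ 2 - (I₂ v - I₂ u))) t 0 :=
    ConvTo.continuousOn_mul (hCc.mono hsub) ((hpconv t ht).const_mul _) (fun s hs => hsq s (hmem s hs))
      fun u v hu huv hv => hsqle u v hu huv (hv.trans ht.2)
  have c3 : ConvTo G (fun u v => C u * (R v - R u) - (P v - P u)) t 0 := by
    refine ConvTo.zero_of_small (hinc hR'c t ht) fun ε hε => ?_
    obtain ⟨δ, hδ, hd⟩ := exists_pos_abs_sub_le hCc hε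
    refine ⟨δ, hδ, fun u v hu huv hv huvδ => ?_⟩
    have hvT := hv.trans ht.2
    have hint : ∀ {f : ℝ → ℝ}, IntervalIntegrable f volume 0 T →
        IntervalIntegrable f volume u v := fun hf => hf.mono_set (by
      rw [uIcc_of_le huv.le, uIcc_of_le hT]; exact Icc_subset_Icc hu hvT)
    simp only [hR, hP, hR']
    rw [integral_sub_of_lt hρ hu huv hvT, integral_sub_of_lt hCρ hu huv hvT,
      integral_sub_of_lt hρ.abs hu huv hvT, ← intervalIntegral.integral_const_mul,
      ← intervalIntegral.integral_sub ((hint hρ).const_mul _) (hint hCρ),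
      ← intervalIntegral.integral_const_mul, ← Real.norm_eq_abs]
    refine intervalIntegral.norm_integral_le_of_norm_le huv.le ?_ ((hint hρ.abs).const_mul _)
    refine Eventually.of_forall fun s hs => ?_
    rw [Real.norm_eq_abs, ← sub_mul, abs_mul, abs_sub_comm]
    gcongr
    exact hd u s hu hs.1 (hs.2.trans hvT) (by linarith [hs.2])
  have c4 : ConvTo G (fun u v => C v - C u - C u * ((X v - X u) + θ u ^ 2 * (S v - S u) ^ 2 / 2))
      t 0 := by
    refine ConvTo.zero_of_small (hpconv t ht) fun ε hε => ?_
    set L := K + 1 + (M ^ 2 + 1) with hL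
    have hL0 : 0 < L := by positivity
    set η := min (1 / 2) (ε / (3 * M' * (M ^ 2 + L))) with hη
    have hη0 : 0 < η := lt_min (by norm_num) (by positivity)
    obtain ⟨δ₁, hδ₁, hd₁⟩ := exists_pos_abs_sub_le hXc (half_pos hη0)
    obtain ⟨δ₂, hδ₂, hd₂⟩ := exists_pos_abs_sub_le hS (ε := η / (2 * M)) (by positivity)
    refine ⟨min δ₁ δ₂, lt_min hδ₁ hδ₂, fun u v hu huv hv huvδ => ?_⟩
    have hvT := hv.trans ht.2
    have huT : u ∈ Icc 0 T := ⟨hu, by linarith⟩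
    obtain ⟨h1, h2, h3⟩ := hparts u v hu huv hvT
    have hX' := hd₁ u v hu huv hvT (huvδ.trans (min_le_left _ _))
    have hS' := hd₂ u v hu huv hvT (huvδ.trans (min_le_right _ _))
    set x := θ u * (S v - S u) with hx
    set y := (X v - X u) - x with hy
    have hxη : |x| ≤ η / 2 := by
      rw [hx, abs_mul]
      calc |θ u| * |S v - S u| ≤ M * (η / (2 * M)) :=
            mul_le_mul (hM u huT) hS' (abs_nonneg _) hM0.le
        _ = η / 2 := by field_simp
    have hyη : |y| ≤ η := (abs_sub _ _).trans (by linarith)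
    have hyp : |y| ≤ L * p u v := by
      have e1 : y = ((I₁ v - I₁ u) - θ u * (S v - S u)) + (-((I₂ v - I₂ u) / 2) + (R v - R u)) := by
        simp only [hy, hX, hx]; ring
      have e2 : |-((I₂ v - I₂ u) / 2) + (R v - R u)| ≤ (0 + (M ^ 2 + 1)) * p u v := by
        refine hle le_rfl (by positivity) hu huv hvT ((abs_add_le _ _).trans ?_)
        have e3 := hI₂le u v hu huv hvT
        have e4 := hRle u v hu huv hvT
        have e5 : 0 ≤ M ^ 2 * (W v - W u) := by positivity
        have e6 : 0 ≤ M ^ 2 * (Q v - Q u) := by positivity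
        have e7 : 0 ≤ M ^ 2 * (R' v - R' u) := by positivity
        rw [abs_neg, abs_div, abs_two]
        simp only [hV]; linarith
      rw [e1]
      refine (abs_add_le _ _).trans ((add_le_add (hele u v hu huv hvT) e2).trans_eq ?_)
      rw [hL]; ring
    have hx2 : x ^ 2 ≤ M ^ 2 * p u v := by
      have : x ^ 2 ≤ (M ^ 2 + 0) * p u v := by
        refine hle (sq_nonneg M) le_rfl hu huv hvT ?_
        rw [zero_mul, add_zero, hx, mul_pow]
        exact mul_le_mul_of_nonneg_right (sq_le_sq.2 ((hM u huT).trans (le_abs_self M))) (sq_nonneg _)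
      simpa using this
    have hexp := abs_exp_add_sub_le (x := x) (y := y) (min_le_left _ _ : η ≤ 1 / 2) (by linarith) hyη
    have e1 : C v - C u - C u * ((X v - X u) + θ u ^ 2 * (S v - S u) ^ 2 / 2) =
        C u * (Real.exp (x + y) - 1 - (x + y) - x ^ 2 / 2) := by
      have : Real.exp (X v) = Real.exp (X u) * Real.exp (x + y) := by
        rw [← Real.exp_add, hy]; congr 1; ring
      have hxy : x + y = X v - X u := by rw [hy]; ring
      rw [hCX v, hCX u, this, hxy, hx]; ring
    rw [e1, abs_mul]
    have hηε : 3 * M' * (M ^ 2 + L) * η ≤ ε := by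
      have := min_le_right (1 / 2) (ε / (3 * M' * (M ^ 2 + L)))
      rw [← hη, le_div_iff₀ (by positivity)] at this
      linarith
    calc |C u| * |Real.exp (x + y) - 1 - (x + y) - x ^ 2 / 2|
        ≤ M' * (3 * η * (M ^ 2 * p u v + L * p u v)) := by
          refine mul_le_mul (hM' u huT) (hexp.trans ?_) (abs_nonneg _) hM'0.le
          gcongr
      _ = 3 * M' * (M ^ 2 + L) * η * p u v := by ring
      _ ≤ ε * p u v := mul_le_mul_of_nonneg_right hηε (hp0 u v hu huv hvT)
  have key := ((((hinc hCc t ht).sub c4).sub c1).sub (c2.const_mul (1 / 2))).sub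
    (c3.add (hinc hPc t ht))
  have hP0 : P 0 = 0 := by simp [hP]
  rw [hP0] at key
  have hlim : C t - C 0 - 0 - 0 - 1 / 2 * 0 - (0 + (P t - 0)) = C t - C 0 - P t := by ring
  rw [hlim] at key
  refine key.congr fun u v _ _ _ => ?_
  simp only [hX]; ring


/-- Differentiation under the integral sign for `C¹` integrands. -/
lemma contDiff_one_integral {E : Type*} [NormedAddCommGroup E] [NormedSpace ℝ E] [ProperSpace E]
    {f : E → ℝ → ℝ} (hf : ContDiff ℝ 1 (Function.uncurry f)) :
    ContDiff ℝ 1 (fun x => ∫ s in (0 : ℝ)..1, f x s) := by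
  have hF' : Continuous (Function.uncurry fun (x : E) (s : ℝ) =>
      (fderiv ℝ (Function.uncurry f) (x, s)).comp (ContinuousLinearMap.inl ℝ E ℝ)) :=
    (hf.continuous_fderiv one_ne_zero).clm_comp_const _
  refine contDiff_one_iff_hasFDerivAt.2 ⟨fun x => ∫ s in (0 : ℝ)..1,
    (fderiv ℝ (Function.uncurry f) (x, s)).comp (ContinuousLinearMap.inl ℝ E ℝ),
    intervalIntegral.continuous_parametric_intervalIntegral_of_continuous' hF' 0 1, fun x => ?_⟩
  obtain ⟨B, hB⟩ := ((isCompact_closedBall x 1).prod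
    (isCompact_Icc (a := (0 : ℝ)) (b := 1))).exists_bound_of_continuousOn hF'.continuousOn
  have hfx : ∀ y, Continuous (f y) := fun y => hf.continuous.comp
    (by fun_prop : Continuous fun s : ℝ => (y, s))
  refine intervalIntegral.hasFDerivAt_integral_of_dominated_of_fderiv_le (bound := fun _ => B)
    (F' := fun x s => (fderiv ℝ (Function.uncurry f) (x, s)).comp (ContinuousLinearMap.inl ℝ E ℝ))
    (Metric.closedBall_mem_nhds x one_pos)
    (Eventually.of_forall fun y => (hfx y).aestronglyMeasurable)
    ((hfx x).intervalIntegrable 0 1) ?_ ?_ intervalIntegrable_const ?_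
  · exact (hF'.comp (by fun_prop : Continuous fun s : ℝ => (x, s))).aestronglyMeasurable
  · refine Eventually.of_forall fun s hs y hy => hB (y, s) ⟨hy, ?_⟩
    rw [uIoc_of_le zero_le_one] at hs
    exact Ioc_subset_Icc_self hs
  · refine Eventually.of_forall fun s _ y _ => ?_
    exact HasFDerivAt.comp (g := Function.uncurry f) (f := fun e : E => (e, s)) y
      (hf.differentiable one_ne_zero (y, s)).hasFDerivAt (hasFDerivAt_prodMk_left y s)

/-- The primitive in the last variable of a `C¹` function is `C¹`. -/
lemma contDiff_one_primitive {E : Type*} [NormedAddCommGroup E] [NormedSpace ℝ E] [ProperSpace E]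
    {h : E → ℝ → ℝ} (hh : ContDiff ℝ 1 (Function.uncurry h)) :
    ContDiff ℝ 1 (Function.uncurry fun a x => ∫ y in (0 : ℝ)..x, h a y) := by
  have key : (Function.uncurry fun a x => ∫ y in (0 : ℝ)..x, h a y) =
      fun q : E × ℝ => q.2 * ∫ s in (0 : ℝ)..1, h q.1 (s * q.2) := by
    ext ⟨a, x⟩
    have := intervalIntegral.mul_integral_comp_mul_right (a := 0) (b := 1) (f := h a) x
    simp only [zero_mul, one_mul] at this
    exact this.symm
  rw [key]
  refine contDiff_snd.mul (contDiff_one_integral (f := fun (q : E × ℝ) s => h q.1 (s * q.2)) ?_)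
  exact hh.comp (by fun_prop : ContDiff ℝ 1 fun z : (E × ℝ) × ℝ => (z.1.1, z.2 * z.1.2))

/-- The reciprocal away from `0` extends to a `C¹` function. -/
lemma exists_contDiff_inv {δ : ℝ} (hδ : 0 < δ) :
    ∃ φ : ℝ → ℝ, ContDiff ℝ 1 φ ∧ ∀ x, δ ≤ x → φ x = x⁻¹ := by
  have hσ : ContDiff ℝ 1 fun x : ℝ => Real.smoothTransition (2 * x / δ - 1) :=
    (Real.smoothTransition.contDiff (n := 1)).comp (by fun_prop)
  refine ⟨fun x => (Real.smoothTransition (2 * x / δ - 1) * x +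
    (1 - Real.smoothTransition (2 * x / δ - 1)))⁻¹, ?_, fun x hx => ?_⟩
  · refine ((hσ.mul contDiff_id).add (contDiff_const.sub hσ)).inv fun x => ne_of_gt ?_
    have h0 := Real.smoothTransition.nonneg (2 * x / δ - 1)
    have h1 := Real.smoothTransition.le_one (2 * x / δ - 1)
    rcases le_or_gt x 0 with hx | hx
    · have : Real.smoothTransition (2 * x / δ - 1) = 0 := by
        refine Real.smoothTransition.zero_of_nonpos ?_
        have : 2 * x / δ ≤ 0 := div_nonpos_of_nonpos_of_nonneg (by linarith) hδ.le
        linarith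
      simp [this]
    · rcases h0.eq_or_lt with h | h
      · simp [← h]
      · simp only [id]
        have := mul_pos h hx
        linarith
  · have : Real.smoothTransition (2 * x / δ - 1) = 1 := by
      refine Real.smoothTransition.one_of_one_le ?_
      have : 2 ≤ 2 * x / δ := by rw [le_div_iff₀ hδ]; linarith
      linarith
    simp [this]

/-- A continuous function of bounded variation is controlled by a continuous monotone one. -/
lemma exists_monotoneOn_control {f : ℝ → ℝ} {T : ℝ} (hT : 0 ≤ T) (hf : ContinuousOn f (Icc 0 T))
    (hbv : BoundedVariationOn f (Icc 0 T)) :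
    ∃ W : ℝ → ℝ, ContinuousOn W (Icc 0 T) ∧ MonotoneOn W (Icc 0 T) ∧
      ∀ u v, 0 ≤ u → u < v → v ≤ T → |f v - f u| ≤ W v - W u := by
  have hl := hbv.locallyBoundedVariationOn
  have h0 : (0 : ℝ) ∈ Icc 0 T := ⟨le_rfl, hT⟩
  refine ⟨variationOnFromTo f (Icc 0 T) 0, fun x hx => ?_, variationOnFromTo.monotoneOn hl h0,
    fun u v hu huv hv => variationOnFromTo.abs_sub_le_sub_of_le hl h0 ⟨hu, by linarith⟩
      ⟨by linarith, hv⟩ huv.le⟩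
  have hl' := variationOnFromTo.tendsto_left h0 hx hl
    ((hf x hx).tendsto.mono_left (nhdsWithin_mono x inter_subset_left))
  have hr' := variationOnFromTo.tendsto_right h0 hx hl
    ((hf x hx).tendsto.mono_left (nhdsWithin_mono x inter_subset_left))
  rw [dist_self, sub_zero] at hl'
  rw [dist_self, add_zero] at hr'
  rw [← continuousWithinAt_sdiff_self]
  have hset : Icc 0 T \ {x} = (Icc 0 T ∩ Iio x) ∪ (Icc 0 T ∩ Ioi x) := by
    rw [← inter_union_distrib_left, Iio_union_Ioi, sdiff_eq]
  rw [hset, ContinuousWithinAt, nhdsWithin_union]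
  exact hl'.sup hr'

/-- A function whose increments are dominated by those of a monotone one has bounded variation. -/
lemma boundedVariationOn_of_abs_sub_le {f W : ℝ → ℝ} {T : ℝ} (hT : 0 ≤ T)
    (h : ∀ u v, 0 ≤ u → u < v → v ≤ T → |f v - f u| ≤ W v - W u) :
    BoundedVariationOn f (Icc 0 T) := by
  have hW : MonotoneOn W (Icc 0 T) := fun u hu v hv huv => by
    rcases huv.eq_or_lt with rfl | huv
    · rfl
    · exact sub_nonneg.1 ((abs_nonneg _).trans (h u v hu.1 huv hv.2))
  have hWbv : eVariationOn W (Icc 0 T) ≠ ⊤ := by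
    have := hW.eVariationOn_eq (a := 0) (b := T) ⟨le_rfl, hT⟩ ⟨hT, le_rfl⟩
    rw [inter_self] at this
    exact this ▸ ENNReal.ofReal_ne_top
  refine ne_top_of_le_ne_top hWbv (iSup_le fun ⟨n, u, hu, hus⟩ => ?_)
  refine le_trans (Finset.sum_le_sum fun i _ => ?_) (eVariationOn.sum_le (n := n) hu hus)
  rw [edist_dist, edist_dist, Real.dist_eq, Real.dist_eq]
  refine ENNReal.ofReal_le_ofReal ?_
  rcases (hu (Nat.le_succ i)).eq_or_lt with he | hlt
  · simp only [Nat.succ_eq_add_one] at he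
    simp [he]
  · exact (h _ _ (hus i).1 hlt (hus _).2).trans (le_abs_self _)

/-- First order expansion of a primitive along a path `(A, S)`, with an error controlled by the
variation of `A` and the squared increments of `S`. -/
lemma exists_primitive_expansion {n : ℕ} {h F : (Fin n → ℝ) → ℝ → ℝ}
    (hh : ContDiff ℝ 1 (Function.uncurry h)) (hF : F = fun a x => ∫ y in (0 : ℝ)..x, h a y)
    {A : ℝ → Fin n → ℝ} {S W : ℝ → ℝ} {T : ℝ} (hA : ContinuousOn A (Icc 0 T))
    (hS : ContinuousOn S (Icc 0 T))
    (hW : ∀ u v, 0 ≤ u → u < v → v ≤ T → ‖A v - A u‖ ≤ W v - W u) :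
    ∃ K ≥ 0, ∀ u v, 0 ≤ u → u < v → v ≤ T →
      |F (A v) (S v) - F (A u) (S u) - h (A u) (S u) * (S v - S u)| ≤
        K * (W v - W u + (S v - S u) ^ 2) := by
  have hFd : ContDiff ℝ 1 (Function.uncurry F) := hF ▸ contDiff_one_primitive hh
  obtain ⟨a, ha⟩ := isCompact_Icc.exists_bound_of_continuousOn hA
  obtain ⟨b, hb⟩ := isCompact_Icc.exists_bound_of_continuousOn hS
  have hD : IsCompact (Metric.closedBall (0 : Fin n → ℝ) a ×ˢ Icc (-b) b) :=
    (isCompact_closedBall _ _).prod isCompact_Icc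
  obtain ⟨K₁, hK₁⟩ :=
    (hFd.locallyLipschitz.locallyLipschitzOn).exists_lipschitzOnWith_of_compact hD
  obtain ⟨K₂, hK₂⟩ :=
    (hh.locallyLipschitz.locallyLipschitzOn).exists_lipschitzOnWith_of_compact hD
  refine ⟨K₁ + K₂, by positivity, fun u v hu huv hv => ?_⟩
  have huT : u ∈ Icc 0 T := ⟨hu, by linarith⟩
  have hvT : v ∈ Icc 0 T := ⟨by linarith, hv⟩
  have hmemA : ∀ t ∈ Icc 0 T, A t ∈ Metric.closedBall (0 : Fin n → ℝ) a := fun t ht =>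
    mem_closedBall_zero_iff.2 (ha t ht)
  have hmemS : ∀ t ∈ Icc 0 T, S t ∈ Icc (-b) b := fun t ht => abs_le.1 (hb t ht)
  have h1 : |F (A v) (S v) - F (A u) (S v)| ≤ K₁ * (W v - W u) := by
    have := hK₁.dist_le_mul (A v, S v) ⟨hmemA v hvT, hmemS v hvT⟩ (A u, S v)
      ⟨hmemA u huT, hmemS v hvT⟩
    rw [Real.dist_eq, Prod.dist_eq, dist_self, max_eq_left dist_nonneg, dist_eq_norm] at this
    exact this.trans (mul_le_mul_of_nonneg_left (hW u v hu huv hv) K₁.2)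
  have hcont : Continuous (h (A u)) := hh.continuous.comp
    (by fun_prop : Continuous fun y : ℝ => (A u, y))
  have h2 : |F (A u) (S v) - F (A u) (S u) - h (A u) (S u) * (S v - S u)| ≤
      K₂ * (S v - S u) ^ 2 := by
    have e : F (A u) (S v) - F (A u) (S u) - h (A u) (S u) * (S v - S u) =
        ∫ y in (S u)..(S v), (h (A u) y - h (A u) (S u)) := by
      rw [intervalIntegral.integral_sub (hcont.intervalIntegrable _ _) intervalIntegrable_const,
        intervalIntegral.integral_const, smul_eq_mul, hF, ← intervalIntegral.integral_interval_sub_left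
        (hcont.intervalIntegrable 0 _) (hcont.intervalIntegrable 0 _)]
      ring
    rw [e, ← Real.norm_eq_abs, ← sq_abs, sq, ← mul_assoc]
    refine intervalIntegral.norm_integral_le_of_norm_le_const fun y hy => ?_
    have hy' := uIoc_subset_uIcc hy
    have hyb : y ∈ Icc (-b) b := uIcc_subset_Icc (hmemS u huT) (hmemS v hvT) hy'
    have := hK₂.dist_le_mul (A u, y) ⟨hmemA u huT, hyb⟩ (A u, S u) ⟨hmemA u huT, hmemS u huT⟩
    rw [Prod.dist_eq, dist_self, max_eq_right dist_nonneg, Real.dist_eq] at this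
    refine this.trans (mul_le_mul_of_nonneg_left ?_ K₂.2)
    rw [Real.dist_eq]
    exact abs_sub_left_of_mem_uIcc hy'
  have h3 : F (A v) (S v) - F (A u) (S u) - h (A u) (S u) * (S v - S u) =
      (F (A v) (S v) - F (A u) (S v)) +
        (F (A u) (S v) - F (A u) (S u) - h (A u) (S u) * (S v - S u)) := by ring
  have h4 : 0 ≤ (K₁ : ℝ) * (S v - S u) ^ 2 := by positivity
  have h5 : 0 ≤ (K₂ : ℝ) * (W v - W u) :=
    mul_nonneg K₂.2 ((norm_nonneg _).trans (hW u v hu huv hv))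
  rw [h3]
  refine (abs_add_le _ _).trans ((add_le_add h1 h2).trans ?_)
  linarith

/-- For `m` admissible, `m / S` is locally a `C¹` function of `(A, S)` whose primitive in the
last variable expands to first order along the path. -/
lemma Admissible.exists_primitive {S m : ℝ → ℝ} {T : ℝ} (hm : Admissible S m) (hT : 0 < T)
    (hS : ContinuousOn S (Icc 0 T)) (hSpos : ∀ t ∈ Icc 0 T, 0 < S t) :
    ∃ (n : ℕ) (h F : (Fin n → ℝ) → ℝ → ℝ) (A : ℝ → Fin n → ℝ) (W : ℝ → ℝ) (K : ℝ),
      ContDiff ℝ 1 (Function.uncurry h) ∧ ContDiff ℝ 1 (Function.uncurry F) ∧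
      (∀ k, ContinuousOn (fun t => A t k) (Icc 0 T) ∧
        BoundedVariationOn (fun t => A t k) (Icc 0 T)) ∧
      (∀ t ∈ Icc 0 T, m t / S t = h (A t) (S t)) ∧
      ContinuousOn W (Icc 0 T) ∧ MonotoneOn W (Icc 0 T) ∧ 0 ≤ K ∧
      ∀ u v, 0 ≤ u → u < v → v ≤ T →
        |F (A v) (S v) - F (A u) (S u) - m u / S u * (S v - S u)| ≤
          K * (W v - W u + (S v - S u) ^ 2) := by
  obtain ⟨n, g, A, hg, hA, hmg⟩ := hm T hT
  obtain ⟨t₀, ht₀, hmin⟩ := isCompact_Icc.exists_isMinOn (nonempty_Icc.2 hT.le) hS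
  obtain ⟨φ, hφ, hφinv⟩ := exists_contDiff_inv (hSpos t₀ ht₀)
  choose W hWc hWm hWle using fun k => exists_monotoneOn_control hT.le (hA k).1 (hA k).2
  have hh : ContDiff ℝ 1 (Function.uncurry fun (a : Fin n → ℝ) x => g a x * φ x) :=
    hg.mul (hφ.comp contDiff_snd)
  have hθ : ∀ t ∈ Icc 0 T, m t / S t = g (A t) (S t) * φ (S t) := fun t ht => by
    rw [hmg t ht, hφinv _ (hmin ht), div_eq_mul_inv]
  have hWnn : ∀ k u v, 0 ≤ u → u < v → v ≤ T → 0 ≤ W k v - W k u := fun k u v hu huv hv =>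
    (abs_nonneg _).trans (hWle k u v hu huv hv)
  obtain ⟨K, hK, hexp⟩ := exists_primitive_expansion hh rfl (continuousOn_pi.2 fun k => (hA k).1) hS
    (W := fun t => ∑ k, W k t) fun u v hu huv hv => by
      rw [← Finset.sum_sub_distrib,
        pi_norm_le_iff_of_nonneg (Finset.sum_nonneg fun k _ => hWnn k u v hu huv hv)]
      intro k
      exact (hWle k u v hu huv hv).trans (Finset.single_le_sum (f := fun k => W k v - W k u)
        (fun k _ => hWnn k u v hu huv hv) (Finset.mem_univ k))
  refine ⟨n, _, _, A, fun t => ∑ k, W k t, K, hh, contDiff_one_primitive hh, hA, hθ,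
    continuousOn_finsetSum _ fun k _ => hWc k,
    fun u hu v hv huv => Finset.sum_le_sum fun k _ => hWm k hu hv huv, hK,
    fun u v hu huv hv => ?_⟩
  rw [hθ u ⟨hu, by linarith⟩]
  exact hexp u v hu huv hv


/-- On a compact interval, the Itô integral of `m / S` along `S` is a continuous function which is
a `C¹` function of `(A, S)` up to a continuous path of finite variation. -/
lemma Admissible.exists_local_structure {G : GridSeq} {S Q m I : ℝ → ℝ} {T : ℝ}
    (hm : Admissible S m) (hT : 0 < T) (hS : ContinuousOn S (Icc 0 T))
    (hSpos : ∀ t ∈ Icc 0 T, 0 < S t) (hQc : ContinuousOn Q (Icc 0 T))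
    (hQS : ∀ t ∈ Icc 0 T, ConvTo G (fun u v => (S v - S u) ^ 2) t (Q t))
    (hI : ∀ t ∈ Icc 0 T, ConvTo G (fun u v => m u / S u * (S v - S u)) t (I t)) :
    ∃ (n : ℕ) (h F : (Fin n → ℝ) → ℝ → ℝ) (A : ℝ → Fin n → ℝ) (W : ℝ → ℝ) (K : ℝ),
      ContDiff ℝ 1 (Function.uncurry h) ∧ ContDiff ℝ 1 (Function.uncurry F) ∧
      (∀ k, ContinuousOn (fun t => A t k) (Icc 0 T) ∧
        BoundedVariationOn (fun t => A t k) (Icc 0 T)) ∧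
      (∀ t ∈ Icc 0 T, m t / S t = h (A t) (S t)) ∧
      ContinuousOn W (Icc 0 T) ∧ MonotoneOn W (Icc 0 T) ∧ 0 ≤ K ∧ ContinuousOn I (Icc 0 T) ∧
      (∀ u v, 0 ≤ u → u < v → v ≤ T →
        |(F (A v) (S v) - I v) - (F (A u) (S u) - I u)| ≤ W v - W u) ∧
      ∀ u v, 0 ≤ u → u < v → v ≤ T →
        |I v - I u - m u / S u * (S v - S u)| ≤ W v - W u + K * (S v - S u) ^ 2 := by
  obtain ⟨n, h, F, A, W, K, hh, hF, hA, hθ, hWc, hWm, hK, hexp⟩ := hm.exists_primitive hT hS hSpos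
  have hΦ : ContinuousOn (fun t => F (A t) (S t)) (Icc 0 T) :=
    hF.continuous.comp_continuousOn ((continuousOn_pi.2 fun k => (hA k).1).prodMk hS)
  have hsub : ∀ {s}, s ∈ Icc 0 T → Icc 0 s ⊆ Icc 0 T := fun hs => Icc_subset_Icc_right hs.2
  have hf : ∀ s ∈ Icc 0 T, ConvTo G
      (fun u v => (F (A v) (S v) - F (A u) (S u)) - m u / S u * (S v - S u)) s
      ((F (A s) (S s) - F (A 0) (S 0)) - I s) := fun s hs =>
    (ConvTo.increments hs.1 (hΦ.mono (hsub hs))).sub (hI s hs)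
  have hp : ∀ s ∈ Icc 0 T, ConvTo G (fun u v => K * ((W v - W u) + (S v - S u) ^ 2)) s
      (K * ((W s - W 0) + Q s)) := fun s hs =>
    ((ConvTo.increments hs.1 (hWc.mono (hsub hs))).add (hQS s hs)).const_mul K
  have hβ : ∀ u v, 0 ≤ u → u < v → v ≤ T →
      |(F (A v) (S v) - I v) - (F (A u) (S u) - I u)| ≤ K * (W v - W u) + K * (Q v - Q u) := by
    intro u v hu huv hv
    have huT : u ∈ Icc 0 T := ⟨hu, by linarith⟩
    have hvT : v ∈ Icc 0 T := ⟨by linarith, hv⟩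
    have := ConvTo.abs_sub_le (hf u huT) (hf v hvT) (hp u huT) (hp v hvT) huv.le
      fun a b ha hab hb => hexp a b ha hab (hb.trans hv)
    convert this using 2 <;> ring
  have hWnn : ∀ u v, 0 ≤ u → u < v → v ≤ T → 0 ≤ K * (W v - W u) := fun u v hu huv hv =>
    mul_nonneg hK (sub_nonneg.2 (hWm ⟨hu, by linarith⟩ ⟨by linarith, hv⟩ huv.le))
  have hQnn : ∀ u v, 0 ≤ u → u < v → v ≤ T → 0 ≤ K * (Q v - Q u) := fun u v hu huv hv =>
    mul_nonneg hK (qv_mono hQS u v hu huv hv)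
  have hW'c : ContinuousOn (fun t => 2 * K * W t + K * Q t) (Icc 0 T) :=
    (hWc.const_mul _).add (hQc.const_mul _)
  have hβ' : ∀ u v, 0 ≤ u → u < v → v ≤ T →
      |(F (A v) (S v) - I v) - (F (A u) (S u) - I u)| ≤
        (2 * K * W v + K * Q v) - (2 * K * W u + K * Q u) := fun u v hu huv hv => by
    linarith [hβ u v hu huv hv, hWnn u v hu huv hv]
  refine ⟨n, h, F, A, fun t => 2 * K * W t + K * Q t, K, hh, hF, hA, hθ, hW'c,
    fun u hu v hv huv => ?_, hK, ?_, hβ', fun u v hu huv hv => ?_⟩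
  · rcases huv.eq_or_lt with rfl | huv
    · rfl
    · have h1 := hWnn u v hu.1 huv hv.2
      have h2 := hQnn u v hu.1 huv hv.2
      simp only
      linarith
  · refine (hΦ.sub (continuousOn_of_abs_sub_le hW'c hβ')).congr fun t _ => ?_
    simp
  · have h1 := hexp u v hu huv hv
    have h2 := hβ u v hu huv hv
    have e : I v - I u - m u / S u * (S v - S u) =
        (F (A v) (S v) - F (A u) (S u) - m u / S u * (S v - S u)) -
          ((F (A v) (S v) - I v) - (F (A u) (S u) - I u)) := by ring
    rw [e]
    refine (abs_sub _ _).trans ?_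
    linarith

/-- The exponential `C = c exp (F (A, S) - b)` times an admissible `h (A, S)` is again of the form
`g (A', S)`, where `A'` is the path `A` extended by the component `b`. -/
lemma exists_admissible_form_mul_exp {n : ℕ} {h F : (Fin n → ℝ) → ℝ → ℝ} {A : ℝ → Fin n → ℝ}
    {S b ξ : ℝ → ℝ} {T c : ℝ} (hh : ContDiff ℝ 1 (Function.uncurry h))
    (hF : ContDiff ℝ 1 (Function.uncurry F))
    (hA : ∀ k, ContinuousOn (fun t => A t k) (Icc 0 T) ∧
      BoundedVariationOn (fun t => A t k) (Icc 0 T))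
    (hb : ContinuousOn b (Icc 0 T)) (hbv : BoundedVariationOn b (Icc 0 T))
    (hξ : ∀ t ∈ Icc 0 T, ξ t = h (A t) (S t) * (c * Real.exp (F (A t) (S t) - b t))) :
    ∃ (n : ℕ) (g : (Fin n → ℝ) → ℝ → ℝ) (A : ℝ → Fin n → ℝ),
      ContDiff ℝ 1 (Function.uncurry g) ∧
      (∀ k, ContinuousOn (fun t => A t k) (Icc 0 T) ∧
        BoundedVariationOn (fun t => A t k) (Icc 0 T)) ∧
      ∀ t ∈ Icc 0 T, ξ t = g (A t) (S t) := by
  have htail : ContDiff ℝ 1 fun q : (Fin (n + 1) → ℝ) × ℝ => (Fin.tail q.1, q.2) :=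
    ContDiff.prodMk (contDiff_pi.2 fun k : Fin n =>
      (contDiff_apply ℝ ℝ k.succ).comp contDiff_fst) contDiff_snd
  refine ⟨n + 1, fun a x => h (Fin.tail a) x * (c * Real.exp (F (Fin.tail a) x - a 0)),
    fun t => Fin.cons (b t) (A t), ?_, fun k => ?_, fun t ht => ?_⟩
  · exact (hh.comp htail).mul (contDiff_const.mul (Real.contDiff_exp.comp
      ((hF.comp htail).sub ((contDiff_apply ℝ ℝ (0 : Fin (n + 1))).comp contDiff_fst))))
  · refine Fin.cases ?_ (fun k => ?_) k
    · simpa only [Fin.cons_zero] using ⟨hb, hbv⟩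
    · simpa only [Fin.cons_succ] using hA k
  · simpa only [Fin.tail_cons, Fin.cons_zero] using hξ t ht

/-- the DPPI cushion satisfies the pathwise integral equation
`C_t − C_0 = ∫_0^t (m C / S) dS + ∫_0^t (1 − m) C r ds`. -/
theorem stmt14 (G : GridSeq) (S QS r m B : ℝ → ℝ)
    (hS : ContinuousOn S (Set.Ici 0)) (hSpos : ∀ t ∈ Set.Ici (0 : ℝ), 0 < S t)
    (hQS : HasQV G S QS)
    (hm : Admissible S m)
    (hr : ∀ t > 0, IntervalIntegrable r MeasureTheory.volume 0 t)
    (hB : ∀ t, B t = Real.exp (∫ s in (0 : ℝ)..t, r s))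
    (V₀ α : ℝ) (hV₀ : 0 ≤ V₀) (hα : α ∈ Set.Icc (0 : ℝ) 1)
    (I₁ I₂ : ℝ → ℝ)
    (hI₁ : ∀ t, ConvTo G (fun u v => m u / S u * (S v - S u)) t (I₁ t))
    (hI₂ : ∀ t, ConvTo G (fun u v => (m u / S u) ^ 2 * (QS v - QS u)) t (I₂ t))
    (C : ℝ → ℝ)
    (hC : ∀ t, C t = (1 - α) * V₀ *
      Real.exp (I₁ t - I₂ t / 2 + ∫ s in (0 : ℝ)..t, (1 - m s) * r s)) :
    Admissible S (fun t => m t * C t / S t) ∧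
    ∀ t ≥ 0, ∃ I,
      ConvTo G (fun u v => m u * C u / S u * (S v - S u)) t I ∧
      C t - C 0 = I + ∫ s in (0 : ℝ)..t, (1 - m s) * C s * r s := by
  have hSI : ∀ T, ContinuousOn S (Icc 0 T) := fun T => hS.mono Icc_subset_Ici_self
  have hQI : ∀ T, ContinuousOn QS (Icc 0 T) := fun T => hQS.1.mono Icc_subset_Ici_self
  have hθc : ∀ T > 0, ContinuousOn (fun t => m t / S t) (Icc 0 T) := by
    intro T hT
    obtain ⟨n, h, -, A, -, -, hh, -, hA, hθ, -⟩ :=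
      hm.exists_primitive hT (hSI T) fun t ht => hSpos t ht.1
    exact (hh.continuous.comp_continuousOn
      ((continuousOn_pi.2 fun k => (hA k).1).prodMk (hSI T))).congr hθ
  have hρ : ∀ T > 0, IntervalIntegrable (fun s => (1 - m s) * r s) volume 0 T := by
    intro T hT
    refine (hr T hT).continuousOn_mul ?_
    rw [uIcc_of_le hT.le]
    refine ((continuousOn_const (c := (1 : ℝ))).sub ((hθc T hT).mul (hSI T))).congr fun t ht => ?_
    simp [div_mul_cancel₀ _ (hSpos t ht.1).ne']
  refine ⟨fun T hT => ?_, fun t ht => ?_⟩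
  · obtain ⟨n, h, F, A, W, K, hh, hF, hA, hθ, hWc, hWm, hK, hI₁c, hβ, -⟩ :=
      hm.exists_local_structure hT (hSI T) (fun t ht => hSpos t ht.1) (hQI T)
        (fun t _ => hQS.2.2 t) (fun t _ => hI₁ t)
    obtain ⟨M, -, hM⟩ := exists_pos_abs_le (hθc T hT)
    have hb : ∀ u v, 0 ≤ u → u < v → v ≤ T →
        |((F (A v) (S v) - I₁ v) + I₂ v / 2 - ∫ s in (0 : ℝ)..v, (1 - m s) * r s) -
          ((F (A u) (S u) - I₁ u) + I₂ u / 2 - ∫ s in (0 : ℝ)..u, (1 - m s) * r s)| ≤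
        (W v + M ^ 2 / 2 * QS v + ∫ s in (0 : ℝ)..v, |(1 - m s) * r s|) -
          (W u + M ^ 2 / 2 * QS u + ∫ s in (0 : ℝ)..u, |(1 - m s) * r s|) := by
      intro u v hu huv hv
      have h1 := abs_le.1 (hβ u v hu huv hv)
      have h2 := abs_le.1 (qv_integral_abs_sub_le (hQI T) (fun t _ => hQS.2.2 t)
        (fun t _ => hI₂ t) hM u v hu huv hv)
      have h3 := abs_le.1 (abs_integral_sub_le (hρ T hT) hu huv hv)
      rw [abs_le]
      constructor <;> linarith [h1.1, h1.2, h2.1, h2.2, h3.1, h3.2]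
    have hbc := continuousOn_of_abs_sub_le
      ((hWc.add ((hQI T).const_mul _)).add (continuousOn_integral hT.le (hρ T hT).abs)) hb
    refine exists_admissible_form_mul_exp hh hF hA hbc
      (boundedVariationOn_of_abs_sub_le hT.le hb) (c := (1 - α) * V₀) fun t ht => ?_
    rw [← hθ t ht, hC t]
    have e : F (A t) (S t) - (F (A t) (S t) - I₁ t + I₂ t / 2 -
        ∫ s in (0 : ℝ)..t, (1 - m s) * r s) =
        I₁ t - I₂ t / 2 + ∫ s in (0 : ℝ)..t, (1 - m s) * r s := by ring
    rw [e]
    ring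
  · have hT : 0 < t + 1 := by linarith
    obtain ⟨n, h, F, A, W, K, -, -, -, -, hWc, hWm, hK, hI₁c, -, hbound⟩ :=
      hm.exists_local_structure hT (hSI _) (fun t ht => hSpos t ht.1) (hQI _)
        (fun t _ => hQS.2.2 t) (fun t _ => hI₁ t)
    have hexp := ConvTo.exponential hT.le (hSI _) (hQI _) (fun t _ => hQS.2.2 t) (hθc _ hT) hI₁c
      (fun t _ => hI₁ t) (fun t _ => hI₂ t) hWc hWm hK hbound (hρ _ hT) hC t ⟨ht, by linarith⟩
    refine ⟨_, hexp.congr fun u v _ _ _ => by ring, ?_⟩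
    have e : ∀ s, (1 - m s) * C s * r s = C s * ((1 - m s) * r s) := fun s => by ring
    simp only [e]
    ring
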